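/- For every relation element r ∈ 𝓡̃_𝒮 ⊆ the free 𝔽₂-vector space on paths of Γ(n,k,𝒮), the image ρ(r) lies in the relation set 𝓡̃_{ρ(𝒮)} for the graph Γ(n,k,ρ(𝒮)), where ρ(𝒮) = {n+1−i : i ∈ 𝒮}. -/

import Mathlib

/-- `x` is an I-state in `V(n,k)`: a subset of `{0,…,n}` with `k` elements. -/
def Istate (n k : ℕ) (x : Finset ℕ) : Prop :=
  x ⊆ Finset.range (n + 1) ∧ x.card = k

/-- Minimal relative weight vector `v_i(x,y) = |y ∩ [i,n]| − |x ∩ [i,n]|`. -/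
def vwt (n : ℕ) (x y : Finset ℕ) (i : ℕ) : ℤ :=
  ((y ∩ Finset.Icc i n).card : ℤ) - ((x ∩ Finset.Icc i n).card : ℤ)

/-- Minimal relative grading vector `|v|_i(x,y) = |v_i(x,y)|`. -/
def avwt (n : ℕ) (x y : Finset ℕ) (i : ℕ) : ℤ := |vwt n x y i|

/-- Edge labels of the quiver `Γ(n,k,𝒮)`. -/
inductive Lab : Type
  | R : ℕ → Lab
  | L : ℕ → Lab
  | U : ℕ → Lab
  | C : ℕ → Lab
deriving DecidableEq

/-- The target vertex of the edge with label `l` starting at `x`. -/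
def step (x : Finset ℕ) : Lab → Finset ℕ
  | .R i => insert i (x.erase (i - 1))
  | .L i => insert (i - 1) (x.erase i)
  | .U _ => x
  | .C _ => x

/-- Whether the edge with label `l` exists at the vertex `x` in `Γ(n,k,S)`
(for `Γ(n,k)` take `S = ∅`). -/
def validEdge (n : ℕ) (S : Set ℕ) (x : Finset ℕ) : Lab → Prop
  | .R i => 1 ≤ i ∧ i ≤ n ∧ (i - 1) ∈ x ∧ i ∉ x
  | .L i => 1 ≤ i ∧ i ≤ n ∧ i ∈ x ∧ (i - 1) ∉ x
  | .U i => 1 ≤ i ∧ i ≤ n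
  | .C i => i ∈ S

/-- Whether the list of labels `ls` describes a path of `Γ(n,k,S)` starting at `x`.
A path is recorded as its start vertex together with the list of labels of its edges
(the intermediate vertices are then determined). -/
def validPath (n : ℕ) (S : Set ℕ) : Finset ℕ → List Lab → Prop
  | _, [] => True
  | x, l :: ls => validEdge n S x l ∧ validPath n S (step x l) ls

/-- The end vertex of the path starting at `x` with labels `ls`. -/
def endpt : Finset ℕ → List Lab → Finset ℕ
  | x, [] => x
  | x, l :: ls => endpt (step x l) ls

/-- The basis vector of the free `𝔽₂`-vector space on paths of `Γ(n,k,S)`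
corresponding to the path with start `x` and label list `ls`. -/
noncomputable def pv (x : Finset ℕ) (ls : List Lab) : (Finset ℕ × List Lab) →₀ ZMod 2 :=
  Finsupp.single (x, ls) 1

/-- The relation set `𝓡̃_𝒮 ⊆` free `𝔽₂`-vector space on paths of `Γ(n,k,S)`:
(i) `U`/`C` central relations, (ii) loop relations, (iii) distant commutation
relations, (iv) two-line pass relations, (v) `U` vanishing relations, and
(vi) `C²` vanishing relations. -/
def RelSet (n k : ℕ) (S : Set ℕ) : Set ((Finset ℕ × List Lab) →₀ ZMod 2) :=
  { r | ∃ x : Finset ℕ, Istate n k x ∧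
      ((∃ c l : Lab, ((∃ j, c = Lab.U j) ∨ (∃ j, c = Lab.C j)) ∧
          validEdge n S x c ∧ validEdge n S x l ∧
          r = pv x [c, l] + pv x [l, c]) ∨
       (∃ i, validPath n S x [Lab.R i, Lab.L i] ∧
          r = pv x [Lab.R i, Lab.L i] + pv x [Lab.U i]) ∨
       (∃ i, validPath n S x [Lab.L i, Lab.R i] ∧
          r = pv x [Lab.L i, Lab.R i] + pv x [Lab.U i]) ∨
       (∃ i j : ℕ, ∃ a b : Lab, 1 < |(i : ℤ) - (j : ℤ)| ∧
          (a = Lab.R i ∨ a = Lab.L i) ∧ (b = Lab.R j ∨ b = Lab.L j) ∧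
          validPath n S x [a, b] ∧ validPath n S x [b, a] ∧
          endpt x [a, b] = endpt x [b, a] ∧
          r = pv x [a, b] + pv x [b, a]) ∨
       (∃ i, validPath n S x [Lab.R i, Lab.R (i + 1)] ∧
          r = pv x [Lab.R i, Lab.R (i + 1)]) ∨
       (∃ i, validPath n S x [Lab.L (i + 1), Lab.L i] ∧
          r = pv x [Lab.L (i + 1), Lab.L i]) ∨
       (∃ i, 1 ≤ i ∧ i ≤ n ∧ (i - 1) ∉ x ∧ i ∉ x ∧ r = pv x [Lab.U i]) ∨
       (∃ i, i ∈ S ∧ r = pv x [Lab.C i, Lab.C i])) }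

/-- The label part of the symmetry `ρ`: `R_i ↦ L_{n+1−i}`, `L_i ↦ R_{n+1−i}`,
`U_i ↦ U_{n+1−i}`, `C_i ↦ C_{n+1−i}`. -/
def rhoLab (n : ℕ) : Lab → Lab
  | .R i => .L (n + 1 - i)
  | .L i => .R (n + 1 - i)
  | .U i => .U (n + 1 - i)
  | .C i => .C (n + 1 - i)

/-- The vertex part of the symmetry `ρ`: `ρ(x) = {n − a : a ∈ x}`. -/
def rhoVert (n : ℕ) (x : Finset ℕ) : Finset ℕ := x.image (fun a => n - a)

/-- The symmetry `ρ` on paths: the path starting at `x` with labels `ls` is sent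
to the path starting at `ρ(x)` whose labels are the `ρ`-images of the labels of
`ls`, in the same order. -/
def rhoPath (n : ℕ) : Finset ℕ × List Lab → Finset ℕ × List Lab :=
  fun p => (rhoVert n p.1, p.2.map (rhoLab n))

theorem mem_rhoVert {n : ℕ} {x : Finset ℕ} (hx : x ⊆ Finset.range (n + 1)) {a : ℕ}
    (ha : a ≤ n) : a ∈ rhoVert n x ↔ n - a ∈ x := by
  unfold rhoVert
  rw [Finset.mem_image]
  constructor
  · rintro ⟨b, hb, rfl⟩
    have := Finset.mem_range.1 (hx hb)
    rwa [Nat.sub_sub_self (by omega)]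
  · exact fun h => ⟨n - a, h, by omega⟩

theorem rhoVert_subset (n : ℕ) (x : Finset ℕ) : rhoVert n x ⊆ Finset.range (n + 1) := by
  intro a ha
  obtain ⟨b, -, rfl⟩ := Finset.mem_image.1 ha
  exact Finset.mem_range.2 (by omega)

theorem Istate.rhoVert {n k : ℕ} {x : Finset ℕ} (hx : Istate n k x) :
    Istate n k (rhoVert n x) := by
  refine ⟨rhoVert_subset n x, ?_⟩
  rw [← hx.2]
  refine Finset.card_image_of_injOn fun a ha b hb h => ?_
  have := Finset.mem_range.1 (hx.1 ha)
  have := Finset.mem_range.1 (hx.1 hb)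
  omega

theorem validEdge.step_subset {n : ℕ} {S : Set ℕ} {x : Finset ℕ} {l : Lab}
    (hx : x ⊆ Finset.range (n + 1)) (h : validEdge n S x l) :
    step x l ⊆ Finset.range (n + 1) := by
  cases l with
  | U i => exact hx
  | C i => exact hx
  | R i =>
    exact Finset.insert_subset (Finset.mem_range.2 (by have := h.2.1; omega))
      ((Finset.erase_subset _ _).trans hx)
  | L i =>
    exact Finset.insert_subset (Finset.mem_range.2 (by have := h.2.1; omega))
      ((Finset.erase_subset _ _).trans hx)

theorem validEdge.rho {n : ℕ} {S : Set ℕ} {x : Finset ℕ} {l : Lab}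
    (hx : x ⊆ Finset.range (n + 1)) (h : validEdge n S x l) :
    validEdge n ((fun i => n + 1 - i) '' S) (rhoVert n x) (rhoLab n l) := by
  cases l with
  | U i => obtain ⟨h1, h2⟩ := h; exact ⟨by omega, by omega⟩
  | C i => exact ⟨i, h, rfl⟩
  | R i =>
    obtain ⟨h1, h2, h3, h4⟩ := h
    refine ⟨by omega, by omega, ?_, ?_⟩
    · rw [mem_rhoVert hx (by omega), show n - (n + 1 - i) = i - 1 by omega]
      exact h3
    · rw [mem_rhoVert hx (by omega), show n - (n + 1 - i - 1) = i by omega]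
      exact h4
  | L i =>
    obtain ⟨h1, h2, h3, h4⟩ := h
    refine ⟨by omega, by omega, ?_, ?_⟩
    · rw [mem_rhoVert hx (by omega), show n - (n + 1 - i - 1) = i by omega]
      exact h3
    · rw [mem_rhoVert hx (by omega), show n - (n + 1 - i) = i - 1 by omega]
      exact h4

theorem rhoVert_insert_erase {n : ℕ} {x : Finset ℕ} (hx : x ⊆ Finset.range (n + 1)) {a b : ℕ}
    (hb : b ≤ n) :
    rhoVert n (insert a (x.erase b)) = insert (n - a) ((rhoVert n x).erase (n - b)) := by
  unfold rhoVert
  rw [Finset.image_insert]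
  congr 1
  ext c
  simp only [Finset.mem_image, Finset.mem_erase]
  constructor
  · rintro ⟨d, ⟨hdb, hd⟩, rfl⟩
    have := Finset.mem_range.1 (hx hd)
    exact ⟨by omega, d, hd, rfl⟩
  · rintro ⟨hc, d, hd, rfl⟩
    exact ⟨d, ⟨fun h => hc (by rw [h]), hd⟩, rfl⟩

theorem validEdge.rhoVert_step {n : ℕ} {S : Set ℕ} {x : Finset ℕ} {l : Lab}
    (hx : x ⊆ Finset.range (n + 1)) (h : validEdge n S x l) :
    rhoVert n (step x l) = step (rhoVert n x) (rhoLab n l) := by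
  cases l with
  | U i => rfl
  | C i => rfl
  | R i =>
    obtain ⟨h1, h2, -⟩ := h
    simp only [step, rhoLab]
    rw [rhoVert_insert_erase hx (by omega), show n + 1 - i - 1 = n - i by omega,
      show n + 1 - i = n - (i - 1) by omega]
  | L i =>
    obtain ⟨h1, h2, -⟩ := h
    simp only [step, rhoLab]
    rw [rhoVert_insert_erase hx h2, show n + 1 - i - 1 = n - i by omega,
      show n + 1 - i = n - (i - 1) by omega]

theorem validPath.rho {n : ℕ} {S : Set ℕ} {ls : List Lab} {x : Finset ℕ}
    (hx : x ⊆ Finset.range (n + 1)) (h : validPath n S x ls) :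
    validPath n ((fun i => n + 1 - i) '' S) (rhoVert n x) (ls.map (rhoLab n)) := by
  induction ls generalizing x with
  | nil => trivial
  | cons l ls ih =>
    refine ⟨h.1.rho hx, ?_⟩
    rw [← h.1.rhoVert_step hx]
    exact ih (h.1.step_subset hx) h.2

theorem validPath.rhoVert_endpt {n : ℕ} {S : Set ℕ} {ls : List Lab} {x : Finset ℕ}
    (hx : x ⊆ Finset.range (n + 1)) (h : validPath n S x ls) :
    rhoVert n (endpt x ls) = endpt (rhoVert n x) (ls.map (rhoLab n)) := by
  induction ls generalizing x with
  | nil => rfl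
  | cons l ls ih =>
    simp only [endpt, List.map_cons]
    rw [← h.1.rhoVert_step hx]
    exact ih (h.1.step_subset hx) h.2

theorem mapDomain_rhoPath_pv (n : ℕ) (x : Finset ℕ) (ls : List Lab) :
    Finsupp.mapDomain (rhoPath n) (pv x ls) = pv (rhoVert n x) (ls.map (rhoLab n)) :=
  Finsupp.mapDomain_single

theorem validEdge.index_le {n : ℕ} {S : Set ℕ} {x : Finset ℕ} {l : Lab} {i : ℕ}
    (hl : l = Lab.R i ∨ l = Lab.L i) (h : validEdge n S x l) : i ≤ n := by
  rcases hl with rfl | rfl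
  · exact h.2.1
  · exact h.2.1

theorem rhoLab_eq_R_or_L {l : Lab} {i : ℕ} (n : ℕ) (hl : l = Lab.R i ∨ l = Lab.L i) :
    rhoLab n l = Lab.R (n + 1 - i) ∨ rhoLab n l = Lab.L (n + 1 - i) := by
  rcases hl with rfl | rfl
  · exact Or.inr rfl
  · exact Or.inl rfl

/-- For every relation element `r ∈ 𝓡̃_𝒮`, the image `ρ(r)` (under the
`𝔽₂`-linear extension of `ρ` to the free vector space on paths) lies in the
relation set `𝓡̃_{ρ(𝒮)}`, where `ρ(𝒮) = {n+1−i : i ∈ 𝒮}`. -/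
theorem stmt18 (n k : ℕ) (hn : 1 ≤ n) (S : Set ℕ) (hS : S ⊆ {i : ℕ | 1 ≤ i ∧ i ≤ n})
    (r : (Finset ℕ × List Lab) →₀ ZMod 2) (hr : r ∈ RelSet n k S) :
    Finsupp.mapDomain (rhoPath n) r ∈ RelSet n k ((fun i => n + 1 - i) '' S) := by
  obtain ⟨x, hx, h⟩ := hr
  refine ⟨rhoVert n x, hx.rhoVert, ?_⟩
  rcases h with ⟨c, l, hc, hvc, hvl, rfl⟩ | ⟨i, hv, rfl⟩ | ⟨i, hv, rfl⟩ |
    ⟨i, j, a, b, hij, ha, hb, hab, hba, he, rfl⟩ | ⟨i, hv, rfl⟩ | ⟨i, hv, rfl⟩ |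
    ⟨i, h1, h2, h3, h4, rfl⟩ | ⟨i, hi, rfl⟩ <;>
    simp only [Finsupp.mapDomain_add, mapDomain_rhoPath_pv]
  · refine Or.inl ⟨rhoLab n c, rhoLab n l, ?_, hvc.rho hx.1, hvl.rho hx.1, rfl⟩
    rcases hc with ⟨j, rfl⟩ | ⟨j, rfl⟩
    · exact Or.inl ⟨_, rfl⟩
    · exact Or.inr ⟨_, rfl⟩
  · exact Or.inr (Or.inr (Or.inl ⟨n + 1 - i, hv.rho hx.1, rfl⟩))
  · exact Or.inr (Or.inl ⟨n + 1 - i, hv.rho hx.1, rfl⟩)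
  · refine Or.inr (Or.inr (Or.inr (Or.inl ⟨n + 1 - i, n + 1 - j, rhoLab n a, rhoLab n b, ?_,
      rhoLab_eq_R_or_L n ha, rhoLab_eq_R_or_L n hb, hab.rho hx.1, hba.rho hx.1, ?_, rfl⟩)))
    · have hi := hab.1.index_le ha
      have hj := hba.1.index_le hb
      rw [Nat.cast_sub (by omega), Nat.cast_sub (by omega), sub_sub_sub_cancel_left, abs_sub_comm]
      exact hij
    · exact (hab.rhoVert_endpt hx.1).symm.trans
        ((congrArg (rhoVert n) he).trans (hba.rhoVert_endpt hx.1))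
  · have hi : i + 1 ≤ n := hv.2.1.2.1
    have hρ := hv.rho hx.1
    simp only [List.map_cons, List.map_nil, rhoLab, show n + 1 - i = n - i + 1 by omega,
      show n + 1 - (i + 1) = n - i by omega] at hρ ⊢
    exact Or.inr (Or.inr (Or.inr (Or.inr (Or.inr (Or.inl ⟨n - i, hρ, rfl⟩)))))
  · have hi : i + 1 ≤ n := hv.1.2.1
    have hρ := hv.rho hx.1
    simp only [List.map_cons, List.map_nil, rhoLab, show n + 1 - i = n - i + 1 by omega,
      show n + 1 - (i + 1) = n - i by omega] at hρ ⊢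
    exact Or.inr (Or.inr (Or.inr (Or.inr (Or.inl ⟨n - i, hρ, rfl⟩))))
  · refine Or.inr (Or.inr (Or.inr (Or.inr (Or.inr (Or.inr (Or.inl
      ⟨n + 1 - i, by omega, by omega, ?_, ?_, rfl⟩))))))
    · rw [mem_rhoVert hx.1 (by omega), show n - (n + 1 - i - 1) = i by omega]
      exact h4
    · rw [mem_rhoVert hx.1 (by omega), show n - (n + 1 - i) = i - 1 by omega]
      exact h3
  · exact Or.inr (Or.inr (Or.inr (Or.inr (Or.inr (Or.inr (Or.inr
      ⟨n + 1 - i, ⟨i, hi, rfl⟩, rfl⟩))))))
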